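/- Let (C_n, ∂_n)_{n≥0} be a chain complex of free abelian groups (each C_n a free ℤ-module, ∂_n : C_n → C_{n−1}, ∂_{n−1} ∘ ∂_n = 0) and let A be an abelian group. Form the cochain complex Cⁿ := Hom_ℤ(C_n, A) with coboundary δⁿ(φ) := φ ∘ ∂_{n+1}, and let Hⁿ denote its cohomology and H_n := ker ∂_n / im ∂_{n+1} the homology of C, with H_{−1} := 0. For each n ≥ 0, the evaluation map ρⁿ : Hⁿ → Hom_ℤ(H_n, A), sending the class of a cocycle ξ (i.e. ξ ∘ ∂_{n+1} = 0) to the homomorphism z + im ∂_{n+1} ↦ ξ(z) for z ∈ ker ∂_n, is a well-defined surjective group homomorphism, and its kernel is isomorphic to Ext¹_ℤ(H_{n−1}, A). Hence there is a short exact sequence 0 → Ext¹_ℤ(H_{n−1}, A) → Hⁿ → Hom_ℤ(H_n, A) → 0, and this sequence splits. (Theorem 3.2.11, cohomological universal coefficient theorem.) -/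

import Mathlib

open CategoryTheory

universe u

noncomputable section

variable (C : ℕ → Type u) [∀ n, AddCommGroup (C n)] (d : ∀ n, C (n + 1) →ₗ[ℤ] C n)

/-- The `n`-cycles `ker ∂ₙ` of a chain complex `(C, ∂)` of abelian groups, where the
boundary maps are given as `d n = ∂_{n+1} : C (n+1) → C n` and `∂₀ = 0` by convention. -/
def chainCycles : ∀ n : ℕ, Submodule ℤ (C n)
  | 0 => ⊤
  | (n + 1) => LinearMap.ker (d n)

/-- The `n`-boundaries `im ∂_{n+1}` of a chain complex `(C, ∂)` of abelian groups. -/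
def chainBoundaries (n : ℕ) : Submodule ℤ (C n) :=
  LinearMap.range (d n)

/-- The `n`-th homology group `Hₙ = ker ∂ₙ / im ∂_{n+1}` of a chain complex of abelian
groups. -/
def chainHomology (n : ℕ) : Type u :=
  ↥(chainCycles C d n) ⧸ (chainBoundaries C d n).comap (chainCycles C d n).subtype

instance (n : ℕ) : AddCommGroup (chainHomology C d n) :=
  inferInstanceAs (AddCommGroup (↥(chainCycles C d n) ⧸
    (chainBoundaries C d n).comap (chainCycles C d n).subtype))

instance (n : ℕ) : Module ℤ (chainHomology C d n) :=
  inferInstanceAs (Module ℤ (↥(chainCycles C d n) ⧸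
    (chainBoundaries C d n).comap (chainCycles C d n).subtype))

variable (A : Type u) [AddCommGroup A]

/-- The `n`-cocycles of the dual cochain complex `Cⁿ = Hom_ℤ(Cₙ, A)`,
`δⁿ φ = φ ∘ ∂_{n+1}`: the submodule of `φ : Cₙ →ₗ[ℤ] A` with `φ ∘ ∂_{n+1} = 0`. -/
def cochainCocycles (n : ℕ) : Submodule ℤ (C n →ₗ[ℤ] A) :=
  LinearMap.ker (LinearMap.lcomp ℤ A (d n))

/-- The `n`-coboundaries of the dual cochain complex: the image of
`δ^{n-1} : Hom_ℤ(C_{n-1}, A) → Hom_ℤ(Cₙ, A)`, with `δ^{-1} = 0` by convention. -/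
def cochainCoboundaries : ∀ n : ℕ, Submodule ℤ (C n →ₗ[ℤ] A)
  | 0 => ⊥
  | (n + 1) => LinearMap.range (LinearMap.lcomp ℤ A (d n))

/-- The `n`-th cohomology `Hⁿ = ker δⁿ / im δ^{n-1}` of the dual cochain complex
`Hom_ℤ(C_•, A)`. -/
def cochainCohomology (n : ℕ) : Type u :=
  ↥(cochainCocycles C d A n) ⧸
    (cochainCoboundaries C d A n).comap (cochainCocycles C d A n).subtype

instance (n : ℕ) : AddCommGroup (cochainCohomology C d A n) :=
  inferInstanceAs (AddCommGroup (↥(cochainCocycles C d A n) ⧸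
    (cochainCoboundaries C d A n).comap (cochainCocycles C d A n).subtype))

instance (n : ℕ) : Module ℤ (cochainCohomology C d A n) :=
  inferInstanceAs (Module ℤ (↥(cochainCocycles C d A n) ⧸
    (cochainCoboundaries C d A n).comap (cochainCocycles C d A n).subtype))

/-- The homology in the previous degree, `H_{n-1}`, as an object of `ModuleCat ℤ`,
with the convention `H_{-1} = 0`. -/
def chainHomologyPrev : ℕ → ModuleCat.{u} ℤ
  | 0 => ModuleCat.of ℤ PUnit
  | (n + 1) => ModuleCat.of ℤ (chainHomology C d n)

theorem uct_projective_of_injective {M P : Type u} [AddCommGroup M] [AddCommGroup P]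
    [iM : Module ℤ M] [iP : Module ℤ P] [Module.Projective ℤ P] (i : M →ₗ[ℤ] P)
    (hi : Function.Injective i) : Module.Projective ℤ M := by
  obtain rfl : iM = AddCommGroup.toIntModule M := Subsingleton.elim _ _
  obtain rfl : iP = AddCommGroup.toIntModule P := Subsingleton.elim _ _
  refine Module.Projective.of_lifting_property'' fun f hf => ?_
  let I := CharacterModule (M →₀ ℤ) → AddCircle (1 : ℚ)
  let j : (M →₀ ℤ) →+ I :=
    { toFun := fun x c => c x
      map_zero' := funext fun c => map_zero c
      map_add' := fun x y => funext fun c => map_add c x y }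
  have hj : Function.Injective j := (injective_iff_map_eq_zero _).2 fun x hx =>
    CharacterModule.eq_zero_of_character_apply fun c => congrFun hx c
  let K : AddSubgroup I := AddSubgroup.map j f.toAddMonoidHom.ker
  let _ : DivisibleBy (I ⧸ K) ℤ :=
    Function.Surjective.divisibleBy (A := I) (α := ℤ) (QuotientAddGroup.mk' K)
      (QuotientAddGroup.mk'_surjective K) (fun a n => map_zsmul _ _ _)
  let g : M →+ I ⧸ K := f.toAddMonoidHom.liftOfSurjective hf
    ⟨(QuotientAddGroup.mk' K).comp j, fun x hx => by
      rw [AddMonoidHom.mem_ker, AddMonoidHom.comp_apply, ← AddMonoidHom.mem_ker,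
        QuotientAddGroup.ker_mk']
      exact ⟨x, hx, rfl⟩⟩
  have hg : ∀ x, g (f x) = QuotientAddGroup.mk' K (j x) := fun x =>
    AddMonoidHom.liftOfRightInverse_comp_apply f.toAddMonoidHom _ _ _ x
  obtain ⟨h, hh⟩ := (Module.Baer.of_divisible (I ⧸ K)).extension_property_addMonoidHom
    i.toAddMonoidHom hi g
  obtain ⟨k, hk⟩ := Module.projective_lifting_property
    (QuotientAddGroup.mk' K).toIntLinearMap h.toIntLinearMap (QuotientAddGroup.mk'_surjective K)
  have key : ∀ m, ∃ x, j x = k (i m) ∧ f x = m := by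
    intro m
    obtain ⟨x, rfl⟩ := hf m
    have h1 : QuotientAddGroup.mk' K (j x) = QuotientAddGroup.mk' K (k (i (f x))) := by
      rw [← hg, ← hh]
      exact (LinearMap.congr_fun hk (i (f x))).symm
    rw [QuotientAddGroup.mk'_eq_mk'] at h1
    obtain ⟨z, ⟨y, hy, rfl⟩, hz⟩ := h1
    have hy' : f y = 0 := hy
    exact ⟨x + y, by rw [map_add, hz], by rw [map_add, hy', add_zero]⟩
  choose s hs1 hs2 using key
  refine ⟨(AddMonoidHom.mk' s fun a b => hj ?_).toIntLinearMap.restrictScalars ℤ, ?_⟩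
  · simp [hs1]
  · ext m
    exact hs2 m

section
variable {B Z H : ModuleCat.{u} ℤ} (i : B ⟶ Z) (p : Z ⟶ H) (w : i ≫ p = 0)

def uctX (B Z : ModuleCat.{u} ℤ) : ℕ → ModuleCat.{u} ℤ
  | 0 => Z
  | 1 => B
  | _ + 2 => ModuleCat.of ℤ PUnit

def uctD : ∀ a b : ℕ, uctX B Z a ⟶ uctX B Z b
  | 1, 0 => i
  | _, _ => 0

def uctComplex : ChainComplex (ModuleCat.{u} ℤ) ℕ where
  X := uctX B Z
  d := uctD i
  shape a b h := by
    match a, b with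
    | 1, 0 => exact absurd rfl h
    | 0, _ => rfl
    | 1, _ + 1 => rfl
    | _ + 2, _ => rfl
  d_comp_d' a b c h1 h2 := by
    match a, b, c with
    | 1, 0, c => exact Limits.comp_zero
    | 0, _, _ => exact Limits.zero_comp
    | 1, _ + 1, _ => exact Limits.zero_comp
    | _ + 2, _, _ => exact Limits.zero_comp

def uctResolution [Projective B] [Projective Z] (hi : Function.Injective i)
    (hp : Function.Surjective p) (hex : Function.Exact i p) : ProjectiveResolution H where
  complex := uctComplex i
  projective n := by
    match n with
    | 0 => exact inferInstanceAs (Projective Z)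
    | 1 => exact inferInstanceAs (Projective B)
    | n + 2 =>
      apply Limits.IsZero.projective
      exact ModuleCat.isZero_of_subsingleton (ModuleCat.of ℤ PUnit)
  π := (ChainComplex.toSingle₀Equiv _ _).symm ⟨p, w⟩
  quasiIso := ⟨fun n => by
    cases n
    · rw [ChainComplex.quasiIsoAt₀_iff, ShortComplex.quasiIso_iff_of_zeros']
      · have : (ShortComplex.mk i p w).Exact ∧ Epi p :=
          ⟨(ShortComplex.ShortExact.moduleCat_exact_iff_function_exact _).2 hex,
            (ModuleCat.epi_iff_surjective _).2 hp⟩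
        refine (ShortComplex.exact_and_epi_g_iff_of_iso ?_).2 this
        exact ShortComplex.isoMk (Iso.refl _) (Iso.refl _) (Iso.refl _)
          (by simp; rfl) (by simp; rfl)
      all_goals rfl
    · rename_i n
      rw [quasiIsoAt_iff_exactAt']
      · rw [HomologicalComplex.exactAt_iff' _ (n + 1 + 1) (n + 1) n (by simp) (by simp)]
        match n with
        | 0 =>
          rw [ShortComplex.moduleCat_exact_iff]
          intro x hx
          refine ⟨0, ?_⟩
          rw [map_zero]
          exact (hi (hx.trans (map_zero i.hom).symm)).symm
        | n + 1 => 
          apply ShortComplex.exact_of_isZero_X₂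
          exact ModuleCat.isZero_of_subsingleton (ModuleCat.of ℤ PUnit)
      · apply ChainComplex.exactAt_succ_single_obj⟩

theorem uct_homology_aux {R : Type} [Ring R]
    (K : CochainComplex (ModuleCat.{u} R) ℕ) (hK : K.d 1 2 = 0) :
    Nonempty (((K.X 1 : Type u) ⧸ LinearMap.range (K.d 0 1).hom) ≃ₗ[R] K.homology 1) :=
  ⟨(ShortComplex.homologyMapIso (K.isoSc' 0 1 2 (by simp) (by simp)) ≪≫
    (ShortComplex.HomologyData.ofIsColimitCokernelCofork (K.sc' 0 1 2) hK _
      (ModuleCat.cokernelIsColimit _)).left.homologyIso).symm.toLinearEquiv⟩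

theorem uct_ext_aux [Projective B] [Projective Z] (hi : Function.Injective i)
    (hp : Function.Surjective p) (hex : Function.Exact i p) (A : Type u) [AddCommGroup A] :
    Nonempty (((B →ₗ[ℤ] A) ⧸ LinearMap.range (LinearMap.lcomp ℤ A i.hom)) ≃+
      ((Ext ℤ (ModuleCat.{u} ℤ) 1).obj (Opposite.op H)).obj (ModuleCat.of ℤ A)) := by
  have w : i ≫ p = 0 := by
    ext x; exact hex.apply_apply_eq_zero x
  have hK : ((uctComplex i).linearYonedaObj ℤ (ModuleCat.of ℤ A)).d 1 2 = 0 := by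
    rw [ChainComplex.linearYonedaObj_d]
    ext x y
    exact map_zero (ModuleCat.Hom.hom (R := ℤ) (A := B) (B := ModuleCat.of ℤ A) x)
  obtain ⟨E⟩ := uct_homology_aux _ hK
  let e1 : ((Ext ℤ (ModuleCat.{u} ℤ) 1).obj (Opposite.op H)).obj (ModuleCat.of ℤ A) ≅
      ((uctComplex i).linearYonedaObj ℤ (ModuleCat.of ℤ A)).homology 1 :=
    (uctResolution i p w hi hp hex).isoExt (R := ℤ) 1 (ModuleCat.of ℤ A)
  let h : (B →ₗ[ℤ] A) ≃ₗ[ℤ] (((uctComplex i).linearYonedaObj ℤ (ModuleCat.of ℤ A)).X 1 : Type u) :=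
    (ModuleCat.homLinearEquiv (M := B) (N := ModuleCat.of ℤ A) (S := ℤ)).symm
  refine ⟨((Submodule.Quotient.equiv _ _ h ?_).toAddEquiv.trans E.toAddEquiv).trans
    e1.symm.toLinearEquiv.toAddEquiv⟩
  ext x
  constructor
  · rintro ⟨_, ⟨y, rfl⟩, rfl⟩
    exact ⟨ModuleCat.ofHom y, rfl⟩
  · rintro ⟨y, rfl⟩
    exact ⟨_, ⟨ModuleCat.Hom.hom (R := ℤ) (A := Z) (B := ModuleCat.of ℤ A) y, rfl⟩, rfl⟩
end

theorem uct_linearEquiv {M N : Type u} [AddCommGroup M] [AddCommGroup N]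
    [iM : Module ℤ M] [iN : Module ℤ N] (e : M ≃+ N) : Nonempty (M ≃ₗ[ℤ] N) := by
  obtain rfl : iM = AddCommGroup.toIntModule M := Subsingleton.elim _ _
  obtain rfl : iN = AddCommGroup.toIntModule N := Subsingleton.elim _ _
  exact ⟨e.toIntLinearEquiv⟩

theorem uct_retraction (C : ℕ → Type u) [∀ n, AddCommGroup (C n)] [∀ n, Module.Free ℤ (C n)]
    (d : ∀ n, C (n + 1) →ₗ[ℤ] C n) (n : ℕ) :
    ∃ r : C n →ₗ[ℤ] chainCycles C d n, ∀ z : chainCycles C d n, r z = z := by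
  cases n with
  | zero =>
    exact ⟨LinearMap.codRestrict _ LinearMap.id fun x => Submodule.mem_top, fun z => rfl⟩
  | succ n =>
    have : Module.Projective ℤ (LinearMap.range (d n)) :=
      uct_projective_of_injective (Submodule.subtype _) (Submodule.injective_subtype _)
    obtain ⟨t, ht⟩ := Module.projective_lifting_property (d n).rangeRestrict LinearMap.id
      (d n).surjective_rangeRestrict
    have ht' : ∀ y, d n (t y) = y := fun y => congrArg Subtype.val (LinearMap.congr_fun ht y)
    refine ⟨LinearMap.codRestrict _ (LinearMap.id - t ∘ₗ (d n).rangeRestrict) fun x => ?_,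
      fun z => ?_⟩
    · change d n (x - t ((d n).rangeRestrict x)) = 0
      rw [map_sub, ht']
      exact sub_self _
    · apply Subtype.ext
      change (z : C (n + 1)) - t ((d n).rangeRestrict z) = z
      have h0 : (d n).rangeRestrict z = 0 := Subtype.ext z.2
      rw [h0, map_zero, sub_zero]

theorem uct_boundary_mem (C : ℕ → Type u) [∀ n, AddCommGroup (C n)]
    (d : ∀ n, C (n + 1) →ₗ[ℤ] C n) (hd : ∀ n, (d n).comp (d (n + 1)) = 0) (n : ℕ)
    (x : C (n + 1)) : d n x ∈ chainCycles C d n := by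
  cases n with
  | zero => exact Submodule.mem_top
  | succ n => exact LinearMap.congr_fun (hd n) x

theorem uct_coboundary_apply (C : ℕ → Type u) [∀ n, AddCommGroup (C n)]
    (d : ∀ n, C (n + 1) →ₗ[ℤ] C n) (A : Type u) [AddCommGroup A] (n : ℕ)
    (ξ : C n →ₗ[ℤ] A) (hξ : ξ ∈ cochainCoboundaries C d A n)
    (z : C n) (hz : z ∈ chainCycles C d n) : ξ z = 0 := by
  cases n with
  | zero =>
    have : ξ = 0 := hξ
    rw [this]; rfl
  | succ n =>
    obtain ⟨φ, rfl⟩ := hξ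
    have hz' : d n z = 0 := hz
    change φ (d n z) = 0
    rw [hz', map_zero]

/-- The evaluation map. -/
def uctRho (C : ℕ → Type u) [∀ n, AddCommGroup (C n)]
    (d : ∀ n, C (n + 1) →ₗ[ℤ] C n) (A : Type u) [AddCommGroup A] (n : ℕ) :
    cochainCohomology C d A n →ₗ[ℤ] (chainHomology C d n →ₗ[ℤ] A) :=
  Submodule.liftQ _
    { toFun := fun ξ => Submodule.liftQ ((chainBoundaries C d n).comap (chainCycles C d n).subtype)
        (ξ.1 ∘ₗ (chainCycles C d n).subtype) (by
          rintro ⟨_, hz⟩ ⟨y, rfl⟩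
          exact LinearMap.congr_fun (show ξ.1.comp (d n) = 0 from ξ.2) y)
      map_add' := fun ξ η => by
        refine LinearMap.ext fun q => ?_
        obtain ⟨z, rfl⟩ := Submodule.Quotient.mk_surjective _ q
        rfl
      map_smul' := fun m ξ => by
        refine LinearMap.ext fun q => ?_
        obtain ⟨z, rfl⟩ := Submodule.Quotient.mk_surjective _ q
        rfl } (by
      intro ξ hξ
      refine LinearMap.ext fun q => ?_
      obtain ⟨z, rfl⟩ := Submodule.Quotient.mk_surjective _ q
      exact uct_coboundary_apply C d A n ξ.1 hξ z.1 z.2)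

theorem uct_section (C : ℕ → Type u) [∀ n, AddCommGroup (C n)] [∀ n, Module.Free ℤ (C n)]
    (d : ∀ n, C (n + 1) →ₗ[ℤ] C n) (hd : ∀ n, (d n).comp (d (n + 1)) = 0)
    (A : Type u) [AddCommGroup A] (n : ℕ) :
    ∃ s : (chainHomology C d n →ₗ[ℤ] A) →ₗ[ℤ] cochainCohomology C d A n,
      (uctRho C d A n).comp s = LinearMap.id := by
  obtain ⟨r, hr⟩ := uct_retraction C d n
  let q : C n →ₗ[ℤ] chainHomology C d n :=
    (Submodule.mkQ ((chainBoundaries C d n).comap (chainCycles C d n).subtype)) ∘ₗ r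
  have hq : ∀ z : chainCycles C d n, q z = Submodule.Quotient.mk z := fun z =>
    congrArg Submodule.Quotient.mk (hr z)
  let s0 : (chainHomology C d n →ₗ[ℤ] A) →ₗ[ℤ] cochainCocycles C d A n :=
    LinearMap.codRestrict _ (LinearMap.lcomp ℤ A q) (fun f => by
      refine LinearMap.ext fun x => ?_
      change f (q (d n x)) = 0
      have h1 := hq ⟨d n x, uct_boundary_mem C d hd n x⟩
      have h2 : (Submodule.Quotient.mk ⟨d n x, uct_boundary_mem C d hd n x⟩ :
          chainHomology C d n) = 0 := (Submodule.Quotient.mk_eq_zero _).2 ⟨x, rfl⟩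
      exact (congrArg f (h1.trans h2)).trans (map_zero f))
  refine ⟨(Submodule.mkQ _) ∘ₗ s0, ?_⟩
  refine LinearMap.ext fun f => LinearMap.ext fun y => ?_
  obtain ⟨z, rfl⟩ := Submodule.Quotient.mk_surjective _ y
  exact congrArg f (hq z)

theorem uct_kernel_zero (C : ℕ → Type u) [∀ n, AddCommGroup (C n)]
    (d : ∀ n, C (n + 1) →ₗ[ℤ] C n) (A : Type u) [AddCommGroup A] :
    Nonempty (↥(LinearMap.ker (uctRho C d A 0)) ≃+
        ((Ext ℤ (ModuleCat.{u} ℤ) 1).obj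
          (Opposite.op (chainHomologyPrev C d 0))).obj (ModuleCat.of ℤ A)) := by
  have hP : Projective (chainHomologyPrev C d 0) :=
    (ModuleCat.isZero_of_subsingleton (ModuleCat.of ℤ PUnit)).projective
  have h1 := isZero_Ext_succ_of_projective (R := ℤ) (chainHomologyPrev C d 0)
    (ModuleCat.of ℤ A) 0
  have h2 := ModuleCat.subsingleton_of_isZero h1
  have h3 : Subsingleton ↥(LinearMap.ker (uctRho C d A 0)) := by
    refine subsingleton_of_forall_eq 0 ?_
    rintro ⟨y, hy⟩
    obtain ⟨ξ, rfl⟩ := Submodule.Quotient.mk_surjective _ y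
    apply Subtype.ext
    refine (Submodule.Quotient.mk_eq_zero _).2 ?_
    change ξ.1 = 0
    refine LinearMap.ext fun z => ?_
    exact LinearMap.congr_fun hy
      (Submodule.Quotient.mk (⟨z, Submodule.mem_top⟩ : chainCycles C d 0))
  exact ⟨{ toFun := fun _ => 0, invFun := fun _ => 0,
           left_inv := fun _ => Subsingleton.elim _ _,
           right_inv := fun _ => Subsingleton.elim _ _,
           map_add' := fun _ _ => Subsingleton.elim _ _ }⟩

theorem uct_kernel_succ (C : ℕ → Type u) [∀ n, AddCommGroup (C n)] [∀ n, Module.Free ℤ (C n)]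
    (d : ∀ n, C (n + 1) →ₗ[ℤ] C n) (hd : ∀ n, (d n).comp (d (n + 1)) = 0)
    (A : Type u) [AddCommGroup A] (n : ℕ) :
    Nonempty (↥(LinearMap.ker (uctRho C d A (n + 1))) ≃+
        ((Ext ℤ (ModuleCat.{u} ℤ) 1).obj
          (Opposite.op (chainHomologyPrev C d (n + 1)))).obj (ModuleCat.of ℤ A)) := by
  obtain ⟨r, hr⟩ := uct_retraction C d n
  let B := (chainBoundaries C d n).comap (chainCycles C d n).subtype
  have hZ : Module.Projective ℤ (chainCycles C d n) :=
    uct_projective_of_injective (Submodule.subtype _) (Submodule.injective_subtype _)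
  have hB : Module.Projective ℤ B :=
    uct_projective_of_injective (Submodule.subtype _) (Submodule.injective_subtype _)
  have hZ' : Projective (ModuleCat.of ℤ (chainCycles C d n)) :=
    (IsProjective.iff_projective _).1 hZ
  have hB' : Projective (ModuleCat.of ℤ B) := (IsProjective.iff_projective _).1 hB
  obtain ⟨E⟩ := uct_ext_aux (ModuleCat.ofHom B.subtype)
    (ModuleCat.ofHom (Y := chainHomology C d n) B.mkQ)
    B.injective_subtype B.mkQ_surjective (LinearMap.exact_subtype_mkQ B) A
  -- the boundary map corestricted to `B`
  let b : C (n + 1) →ₗ[ℤ] B := LinearMap.codRestrict B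
    (LinearMap.codRestrict _ (d n) (uct_boundary_mem C d hd n)) (fun x => ⟨x, rfl⟩)
  have hb : Function.Surjective b := by
    rintro ⟨y, hy⟩
    obtain ⟨x, hx⟩ := hy
    exact ⟨x, Subtype.ext (Subtype.ext hx)⟩
  have hker : ∀ x, d n x = 0 → b x = 0 := fun x hx => Subtype.ext (Subtype.ext hx)
  let Φ0 : (B →ₗ[ℤ] A) →ₗ[ℤ] cochainCocycles C d A (n + 1) :=
    LinearMap.codRestrict _ (LinearMap.lcomp ℤ A b) (fun f => by
      refine LinearMap.ext fun x => ?_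
      change f (b (d (n + 1) x)) = 0
      rw [hker _ (LinearMap.congr_fun (hd n) x), map_zero])
  let Φ : (B →ₗ[ℤ] A) →ₗ[ℤ] cochainCohomology C d A (n + 1) := (Submodule.mkQ _) ∘ₗ Φ0
  have hΦr : LinearMap.range Φ = LinearMap.ker (uctRho C d A (n + 1)) := by
    ext y
    constructor
    · rintro ⟨β, rfl⟩
      refine LinearMap.ext fun q => ?_
      obtain ⟨z, rfl⟩ := Submodule.Quotient.mk_surjective _ q
      change β (b z) = 0
      rw [hker _ z.2, map_zero]
    · intro hy
      obtain ⟨ξ, rfl⟩ := Submodule.Quotient.mk_surjective _ y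
      have hξ : LinearMap.ker b ≤ LinearMap.ker ξ.1 := by
        intro z hz
        have hz' : z ∈ chainCycles C d (n + 1) :=
          congrArg (fun w : B => (w : chainCycles C d n).1) hz
        exact LinearMap.congr_fun hy
          (Submodule.Quotient.mk (⟨z, hz'⟩ : chainCycles C d (n + 1)))
      refine ⟨(Submodule.liftQ _ ξ.1 hξ) ∘ₗ (b.quotKerEquivOfSurjective hb).symm.toLinearMap, ?_⟩
      refine congrArg (Submodule.Quotient.mk) (Subtype.ext (LinearMap.ext fun x => ?_))
      change Submodule.liftQ _ ξ.1 hξ ((b.quotKerEquivOfSurjective hb).symm (b x)) = ξ.1 x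
      have : (b.quotKerEquivOfSurjective hb).symm (b x) = Submodule.Quotient.mk x :=
        (LinearEquiv.symm_apply_eq _).2 rfl
      rw [this]
      rfl
  have hΦk : LinearMap.range (LinearMap.lcomp ℤ A B.subtype) = LinearMap.ker Φ := by
    ext β
    constructor
    · rintro ⟨α, rfl⟩
      refine (Submodule.Quotient.mk_eq_zero _).2 ?_
      refine ⟨α ∘ₗ r, LinearMap.ext fun x => ?_⟩
      exact congrArg α (hr ⟨d n x, uct_boundary_mem C d hd n x⟩)
    · intro hβ
      obtain ⟨α, hα⟩ := (Submodule.Quotient.mk_eq_zero _).1 hβ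
      refine ⟨α ∘ₗ (chainCycles C d n).subtype, LinearMap.ext fun y => ?_⟩
      obtain ⟨x, rfl⟩ := hb y
      exact LinearMap.congr_fun hα x
  let e1 := (Submodule.quotEquivOfEq _ _ hΦk).toAddEquiv
  let e2 := Φ.quotKerEquivRange.toAddEquiv
  let e3 := (LinearEquiv.ofEq _ _ hΦr).toAddEquiv
  exact ⟨(e1.trans (e2.trans e3)).symm.trans E⟩

/-- **Theorem 3.2.11** (cohomological universal coefficient theorem). Let `(C_•, ∂_•)` be
a chain complex of free abelian groups and `A` an abelian group. Form the cochain complex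
`Cⁿ = Hom_ℤ(Cₙ, A)`, `δⁿ φ = φ ∘ ∂_{n+1}`, with cohomology `Hⁿ`, and let `Hₙ` denote the
homology of `C` (with `H_{-1} = 0`). For each `n`, the evaluation map
`ρⁿ : Hⁿ → Hom_ℤ(Hₙ, A)`, sending the class of a cocycle `ξ` to `z + im ∂_{n+1} ↦ ξ z`,
is a well-defined surjective group homomorphism whose kernel is isomorphic to
`Ext¹_ℤ(H_{n-1}, A)`; hence there is a short exact sequence
`0 → Ext¹_ℤ(H_{n-1}, A) → Hⁿ → Hom_ℤ(Hₙ, A) → 0`, and this sequence splits. -/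
theorem cohomological_universal_coefficients
    (C : ℕ → Type u) [∀ n, AddCommGroup (C n)] [∀ n, Module.Free ℤ (C n)]
    (d : ∀ n, C (n + 1) →ₗ[ℤ] C n)
    (hd : ∀ n, (d n).comp (d (n + 1)) = 0)
    (A : Type u) [AddCommGroup A] (n : ℕ) :
    ∃ ρ : cochainCohomology C d A n →ₗ[ℤ] (chainHomology C d n →ₗ[ℤ] A),
      (∀ (ξ : C n →ₗ[ℤ] A) (hξ : ξ ∈ cochainCocycles C d A n)
          (z : C n) (hz : z ∈ chainCycles C d n),
          ρ (Submodule.Quotient.mk ⟨ξ, hξ⟩) (Submodule.Quotient.mk ⟨z, hz⟩) = ξ z) ∧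
      Function.Surjective ρ ∧
      Nonempty (↥(LinearMap.ker ρ) ≃ₗ[ℤ]
        ((Ext ℤ (ModuleCat.{u} ℤ) 1).obj
          (Opposite.op (chainHomologyPrev C d n))).obj (ModuleCat.of ℤ A)) ∧
      ∃ s : (chainHomology C d n →ₗ[ℤ] A) →ₗ[ℤ] cochainCohomology C d A n,
        ρ.comp s = LinearMap.id := by
  obtain ⟨s, hs⟩ := uct_section C d hd A n
  refine ⟨uctRho C d A n, fun ξ hξ z hz => rfl,
    fun f => ⟨s f, LinearMap.congr_fun hs f⟩, ?_, s, hs⟩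
  cases n with
  | zero =>
    obtain ⟨e⟩ := uct_kernel_zero C d A
    exact uct_linearEquiv e
  | succ n =>
    obtain ⟨e⟩ := uct_kernel_succ C d hd A n
    exact uct_linearEquiv e

end
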